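/- arXiv:1111.6146 — 2 statements merged into one kernel-verified Lean document; each statement's English description precedes it below -/
import Mathlib

section
/- Let w ∈ S_n be defined by inclusions, let (x,y) ∈ D(w) with r := r_w(x,y) > 0, and let (p,q) ∈ E(w) with r_w(p,q) = r. Then, with respect to the ℤⁿ-grading on S, the minor d_{{p,…,p+r−1} ∪ {x+r}, {y−r} ∪ {q−r+1,…,q}} is homogeneous of degree e_{y−r} − e_{x+r}; in particular its degree does not depend on the choice of (p,q). -/
/-- One-line notation value of a permutation of `Fin n` at a position `k ∈ {1,…,n}`;
junk value `0` outside that range. -/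
def pval {n : ℕ} (w : Equiv.Perm (Fin n)) (k : ℕ) : ℕ :=
  if h : 1 ≤ k ∧ k ≤ n then ((w ⟨k - 1, by omega⟩ : Fin n) : ℕ) + 1 else 0

/-- The rank function `r_w(p,q) = #{k ≤ q : w(k) ≥ p}`. -/
def rk {n : ℕ} (w : Equiv.Perm (Fin n)) (p q : ℕ) : ℕ :=
  ((Finset.Icc 1 n).filter fun k => k ≤ q ∧ p ≤ pval w k).card

/-- The Rothe diagram `D(w) = {(p,q) ∈ {1,…,n}² : w(q) < p and w⁻¹(p) > q}`. -/
def Diagram {n : ℕ} (w : Equiv.Perm (Fin n)) : Set (ℕ × ℕ) :=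
  {pq | 1 ≤ pq.1 ∧ pq.1 ≤ n ∧ 1 ≤ pq.2 ∧ pq.2 ≤ n ∧
    pval w pq.2 < pq.1 ∧ pq.2 < pval w.symm pq.1}

/-- The essential set `E(w)`. -/
def EssSet {n : ℕ} (w : Equiv.Perm (Fin n)) : Set (ℕ × ℕ) :=
  {pq | pq ∈ Diagram w ∧ (pq.1, pq.2 + 1) ∉ Diagram w ∧ (pq.1 - 1, pq.2) ∉ Diagram w}

/-- Condition A at `(p,q)`: there is no `k` with `k ≤ q` and `w(k) ≥ p`. -/
def CondA {n : ℕ} (w : Equiv.Perm (Fin n)) (p q : ℕ) : Prop :=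
  ¬ ∃ k, 1 ≤ k ∧ k ≤ n ∧ k ≤ q ∧ p ≤ pval w k

/-- Condition B at `(p,q)`: there is no `k` with `k > q` and `w(k) < p`. -/
def CondB {n : ℕ} (w : Equiv.Perm (Fin n)) (p q : ℕ) : Prop :=
  ¬ ∃ k, 1 ≤ k ∧ k ≤ n ∧ q < k ∧ pval w k < p

/-- `w` is defined by inclusions if every essential set box satisfies Condition A or B. -/
def DefinedByInclusions {n : ℕ} (w : Equiv.Perm (Fin n)) : Prop :=
  ∀ p q, (p, q) ∈ EssSet w → CondA w p q ∨ CondB w p q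

/-- Index type for the variables `z_{i,j}` with `1 ≤ j < i ≤ n`. -/
abbrev Idx (n : ℕ) : Type := {p : ℕ × ℕ // 1 ≤ p.2 ∧ p.2 < p.1 ∧ p.1 ≤ n}

/-- The polynomial ring `S = ℚ[z_{i,j} : 1 ≤ j < i ≤ n]`. -/
abbrev PolyS (n : ℕ) : Type := MvPolynomial (Idx n) ℚ

/-- The variable `z_{i,j}` of `S` (junk value `0` when `(i,j)` is out of range). -/
noncomputable def zvar (n : ℕ) (i j : ℕ) : PolyS n :=
  if h : 1 ≤ j ∧ j < i ∧ i ≤ n then MvPolynomial.X ⟨(i, j), h⟩ else 0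

/-- The `(i,j)` entry of the matrix `M`: `1` on the diagonal, `z_{i,j}` below the
diagonal, `0` above it (rows and columns indexed by `{1,…,n}`). -/
noncomputable def Mmat (n : ℕ) (i j : ℕ) : PolyS n :=
  if i = j ∧ 1 ≤ i ∧ i ≤ n then 1 else zvar n i j

/-- The generalized Plücker coordinate `d_{A,B}`: the minor of `M` with rows `A` and
columns `B`, both listed in increasing order (junk value `0` when `#A ≠ #B`). -/
noncomputable def dminor (n : ℕ) (A B : Finset ℕ) : PolyS n :=
  if h : B.card = A.card then
    Matrix.det (Matrix.of fun i j : Fin A.card =>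
      Mmat n ((A.orderIsoOfFin rfl i : ℕ)) ((B.orderIsoOfFin h j : ℕ)))
  else 0

/-- The ideal `I_{(p,q,r)}` generated by all `d_{A,B}` with `A ⊆ {p,…,n}`,
`B ⊆ {1,…,q}` and `#A = #B = r+1`. -/
noncomputable def Iideal (n p q r : ℕ) : Ideal (PolyS n) :=
  Ideal.span {f | ∃ A B : Finset ℕ, A.card = r + 1 ∧ B.card = r + 1 ∧
    A ⊆ Finset.Icc p n ∧ B ⊆ Finset.Icc 1 q ∧ f = dminor n A B}

/-- The ideal `I_w = Σ_{(p,q) ∈ E(w)} I_{(p,q,r_w(p,q))}`. -/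
noncomputable def Iw {n : ℕ} (w : Equiv.Perm (Fin n)) : Ideal (PolyS n) :=
  ⨆ pq ∈ EssSet w, Iideal n pq.1 pq.2 (rk w pq.1 pq.2)
/-- The `ℤⁿ`-weight (recorded as a function `ℕ → ℤ` on indices) of a monomial of `S`,
where the variable `z_{i,j}` has weight `e_j − e_i`. -/
def wtMono (n : ℕ) (d : Idx n →₀ ℕ) : ℕ → ℤ := fun t =>
  ∑ s ∈ d.support, (d s : ℤ) *
    ((if s.1.2 = t then 1 else 0) - (if s.1.1 = t then 1 else 0))

/-- `f ∈ S` is homogeneous of degree `lam` for the `ℤⁿ`-grading in which `z_{i,j}` has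
degree `e_j − e_i`. -/
def IsHomogOfDeg (n : ℕ) (f : PolyS n) (lam : ℕ → ℤ) : Prop :=
  ∀ d ∈ f.support, wtMono n d = lam
/-- The `i`-th standard basis vector, as a function on all of `ℕ`. -/
def stdVec (i : ℕ) : ℕ → ℤ := fun t => if i = t then 1 else 0

/-- The weight `e_j − e_i` of the variable `z_{i,j}`. -/
def varWeight (n : ℕ) (s : Idx n) : ℕ → ℤ := stdVec s.1.2 - stdVec s.1.1

lemma wtMono_eq_weight (n : ℕ) (d : Idx n →₀ ℕ) :
    wtMono n d = Finsupp.weight (varWeight n) d := by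
  funext t
  simp [wtMono, Finsupp.weight_apply, Finsupp.sum, varWeight, stdVec, Finset.sum_apply]

lemma isHomogOfDeg_of_isWeightedHomogeneous {n : ℕ} {f : PolyS n} {lam : ℕ → ℤ}
    (h : MvPolynomial.IsWeightedHomogeneous (varWeight n) f lam) : IsHomogOfDeg n f lam := by
  intro d hd
  rw [wtMono_eq_weight]
  exact h (MvPolynomial.mem_support_iff.mp hd)

lemma Mmat_isWeightedHomogeneous (n i j : ℕ) :
    MvPolynomial.IsWeightedHomogeneous (varWeight n) (Mmat n i j) (stdVec j - stdVec i) := by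
  unfold Mmat zvar
  split_ifs with h h'
  · rw [h.1, sub_self]
    exact MvPolynomial.isWeightedHomogeneous_one ℚ _
  · exact MvPolynomial.isWeightedHomogeneous_X ℚ (varWeight n) ⟨(i, j), h'⟩
  · exact MvPolynomial.isWeightedHomogeneous_zero ℚ _ _

lemma sum_orderIsoOfFin {M : Type*} [AddCommMonoid M] (A : Finset ℕ) {k : ℕ} (h : A.card = k)
    (f : ℕ → M) : ∑ i : Fin k, f (A.orderIsoOfFin h i) = ∑ a ∈ A, f a := by
  rw [← Finset.sum_coe_sort A f]
  exact Equiv.sum_comp (A.orderIsoOfFin h).toEquiv (fun a : A => f a)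

/-- The minor `d_{A,B}` is homogeneous of degree `∑_{b ∈ B} e_b − ∑_{a ∈ A} e_a`. -/
lemma dminor_isWeightedHomogeneous (n : ℕ) (A B : Finset ℕ) :
    MvPolynomial.IsWeightedHomogeneous (varWeight n) (dminor n A B)
      (∑ b ∈ B, stdVec b - ∑ a ∈ A, stdVec a) := by
  unfold dminor
  split_ifs with h
  · rw [Matrix.det_apply]
    refine MvPolynomial.IsWeightedHomogeneous.sum _ _ _ fun σ _ => ?_
    have key := MvPolynomial.IsWeightedHomogeneous.prod Finset.univ
      (fun i : Fin A.card => Mmat n (A.orderIsoOfFin rfl (σ i) : ℕ) (B.orderIsoOfFin h i : ℕ))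
      (fun i => stdVec (B.orderIsoOfFin h i) - stdVec (A.orderIsoOfFin rfl (σ i)))
      (w := varWeight n) fun i _ => Mmat_isWeightedHomogeneous n _ _
    rw [Finset.sum_sub_distrib, sum_orderIsoOfFin B h,
      Equiv.sum_comp σ (fun i => stdVec (A.orderIsoOfFin rfl i)), sum_orderIsoOfFin A rfl] at key
    rcases Int.units_eq_one_or (Equiv.Perm.sign σ) with hs | hs
    · simpa [hs] using key
    · have hneg := (MvPolynomial.weightedHomogeneousSubmodule ℚ (varWeight n) _).neg_mem key
      rw [hs, Units.neg_smul, one_smul]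
      exact hneg
  · exact MvPolynomial.isWeightedHomogeneous_zero ℚ _ _

lemma pval_mem {n : ℕ} (w : Equiv.Perm (Fin n)) {k : ℕ} (h : 1 ≤ k ∧ k ≤ n) :
    1 ≤ pval w k ∧ pval w k ≤ n := by
  rw [pval, dif_pos h]
  omega

lemma pval_pval_symm {n : ℕ} (w : Equiv.Perm (Fin n)) {k : ℕ} (h : 1 ≤ k ∧ k ≤ n) :
    pval w (pval w.symm k) = k := by
  have h' := pval_mem w.symm h
  rw [pval, dif_pos h']
  simp [pval, h]

lemma pval_symm_pval {n : ℕ} (w : Equiv.Perm (Fin n)) {k : ℕ} (h : 1 ≤ k ∧ k ≤ n) :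
    pval w.symm (pval w k) = k :=
  pval_pval_symm w.symm h

lemma card_pval_lt {n : ℕ} (w : Equiv.Perm (Fin n)) {p : ℕ} (hp : p ≤ n) :
    ((Finset.Icc 1 n).filter fun k => pval w k < p).card = p - 1 := by
  have hcard : (Finset.Icc 1 (p - 1)).card = p - 1 := by simp
  rw [← hcard]
  refine Finset.card_nbij' (pval w) (pval w.symm) ?_ ?_ ?_ ?_
  · intro k hk
    simp only [Finset.coe_filter, Finset.mem_Icc, Set.mem_ofPred_eq] at hk
    have := pval_mem w hk.1
    simp only [Finset.coe_Icc, Set.mem_Icc]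
    omega
  · intro k hk
    simp only [Finset.coe_Icc, Set.mem_Icc] at hk
    have hkn : 1 ≤ k ∧ k ≤ n := by omega
    simp only [Finset.coe_filter, Finset.mem_Icc, Set.mem_ofPred_eq, pval_pval_symm w hkn]
    exact ⟨pval_mem w.symm hkn, by omega⟩
  · intro k hk
    simp only [Finset.coe_filter, Finset.mem_Icc, Set.mem_ofPred_eq] at hk
    exact pval_symm_pval w hk.1
  · intro k hk
    simp only [Finset.coe_Icc, Set.mem_Icc] at hk
    exact pval_pval_symm w (by omega)

/-- Under Condition B, `r_w(p,q) = q - p + 1`. -/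
lemma rk_add_of_condB {n : ℕ} {w : Equiv.Perm (Fin n)} {p q : ℕ} (hp : 1 ≤ p) (hpn : p ≤ n)
    (hq : q ≤ n) (hB : CondB w p q) : rk w p q + p = q + 1 := by
  have hsplit := Finset.card_filter_add_card_filter_not (s := Finset.Icc 1 q)
    (fun k => p ≤ pval w k)
  have h1 : rk w p q = ((Finset.Icc 1 q).filter fun k => p ≤ pval w k).card := by
    unfold rk
    congr 1
    ext k
    simp only [Finset.mem_filter, Finset.mem_Icc]
    constructor <;> intro h <;> refine ⟨?_, ?_⟩ <;> omega
  have h2 : (Finset.Icc 1 q).filter (fun k => ¬ p ≤ pval w k) =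
      (Finset.Icc 1 n).filter fun k => pval w k < p := by
    ext k
    simp only [Finset.mem_filter, Finset.mem_Icc, not_le]
    refine ⟨fun h => ⟨by omega, h.2⟩, fun h => ⟨⟨h.1.1, ?_⟩, h.2⟩⟩
    by_contra hk
    exact hB ⟨k, h.1.1, h.1.2, by omega, h.2⟩
  rw [← h1, h2, card_pval_lt w hpn, Nat.card_Icc] at hsplit
  omega

/-- Let `w` be defined by inclusions, `(x,y) ∈ D(w)` with `r = r_w(x,y) > 0` and
`(p,q) ∈ E(w)` with `r_w(p,q) = r`.  Then the minor
`d_{{p,…,p+r−1} ∪ {x+r}, {y−r} ∪ {q−r+1,…,q}}` is homogeneous of degree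
`e_{y−r} − e_{x+r}`; in particular its degree does not depend on `(p,q)`. -/
theorem generator_degree_dbi {n : ℕ} (w : Equiv.Perm (Fin n))
    (hw : DefinedByInclusions w) {x y p q : ℕ}
    (hxy : (x, y) ∈ Diagram w) (hr : 0 < rk w x y)
    (hpq : (p, q) ∈ EssSet w) (hrk : rk w p q = rk w x y) :
    IsHomogOfDeg n
      (dminor n (Finset.Icc p (p + rk w x y - 1) ∪ {x + rk w x y})
        ({y - rk w x y} ∪ Finset.Icc (q - rk w x y + 1) q))
      (fun t => (if y - rk w x y = t then 1 else 0) -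
        (if x + rk w x y = t then 1 else 0)) := by
  obtain ⟨hp1, hpn, -, hqn, -, -⟩ := hpq.1
  obtain ⟨-, -, hy1, hyn, hyx, -⟩ := hxy
  dsimp only at hp1 hpn hqn hy1 hyn hyx
  have hB : CondB w p q := by
    refine (hw p q hpq).resolve_left fun hA => ?_
    obtain ⟨k, hk⟩ := Finset.card_pos.mp (hrk ▸ hr : 0 < rk w p q)
    simp only [Finset.mem_filter, Finset.mem_Icc] at hk
    exact hA ⟨k, hk.1.1, hk.1.2, hk.2.1, hk.2.2⟩
  have hcount := rk_add_of_condB hp1 hpn hqn hB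
  rw [hrk] at hcount
  generalize rk w x y = r at *
  rw [show p + r - 1 = q by omega, show q - r + 1 = p by omega]
  have hnot : ¬ (y - r ∈ Finset.Icc p q ∧ x + r ∈ Finset.Icc p q) := by
    simp only [Finset.mem_Icc]
    intro h
    exact hB ⟨y, hy1, hyn, by omega, by omega⟩
  apply isHomogOfDeg_of_isWeightedHomogeneous
  rw [Finset.union_comm, ← Finset.insert_eq, ← Finset.insert_eq]
  by_cases hx : x + r ∈ Finset.Icc p q <;> by_cases hy : y - r ∈ Finset.Icc p q
  · exact absurd ⟨hy, hx⟩ hnot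
  · rw [dminor, dif_neg]
    · exact MvPolynomial.isWeightedHomogeneous_zero ℚ _ _
    · rw [Finset.card_insert_of_notMem hy, Finset.insert_eq_of_mem hx]
      omega
  · rw [dminor, dif_neg]
    · exact MvPolynomial.isWeightedHomogeneous_zero ℚ _ _
    · rw [Finset.card_insert_of_notMem hx, Finset.insert_eq_of_mem hy]
      omega
  · have h := dminor_isWeightedHomogeneous n (insert (x + r) (Finset.Icc p q))
      (insert (y - r) (Finset.Icc p q))
    rw [Finset.sum_insert hx, Finset.sum_insert hy, add_sub_add_right_eq_sub] at h
    exact h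
end

section
/- Let F be a field and R = F[a,b,c,d,e,f,g,h,i]. Then the ideal I = (ae−bd, af−cd, bf−ce, ag+bh+ci, dg+eh+fi) has height 3, and every generating set of I has at least 5 elements. -/
/-- The height of a prime ideal `P`: the supremum of the lengths of strictly increasing
chains of prime ideals ending at `P` (i.e. of strictly descending chains below `P`). -/
noncomputable def primeHt {R : Type*} [CommRing R] (P : Ideal R) : ℕ∞ :=
  ⨆ (k : ℕ) (_ : ∃ c : Fin (k + 1) → Ideal R, StrictMono c ∧
    (∀ i, (c i).IsPrime) ∧ c (Fin.last k) = P), (k : ℕ∞)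

/-- The height of an ideal `I`: the infimum of the heights of the primes containing it. -/
noncomputable def idealHt {R : Type*} [CommRing R] (I : Ideal R) : ℕ∞ :=
  ⨅ (P : Ideal R) (_ : P.IsPrime) (_ : I ≤ P), primeHt P

open MvPolynomial

theorem primeHt_eq_height {R : Type*} [CommRing R] (P : Ideal R) [hP : P.IsPrime] :
    primeHt P = P.height := by
  refine le_antisymm ?_ ?_
  · refine iSup₂_le fun k ⟨c, hc, hcp, hcP⟩ => ?_
    have h := Order.length_le_height_last (p := (⟨k, fun i => ⟨c i, hcp i⟩, fun i =>
      hc (Fin.castSucc_lt_succ)⟩ : LTSeries (PrimeSpectrum R)))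
    rw [← PrimeSpectrum.height_eq_orderHeight] at h
    simpa only [RelSeries.last, hcP] using h
  · rw [PrimeSpectrum.height_eq_orderHeight ⟨P, hP⟩, Order.height_eq_iSup_last_eq]
    refine iSup₂_le fun p hp => ?_
    refine le_iSup₂_of_le p.length ⟨fun i => (p i).asIdeal, fun i j hij => p.strictMono hij,
      fun i => (p i).isPrime, ?_⟩ le_rfl
    exact congrArg PrimeSpectrum.asIdeal hp

theorem idealHt_eq_of_le {R : Type*} [CommRing R] {I P : Ideal R} [P.IsPrime] {n : ℕ∞}
    (hIP : I ≤ P) (hP : P.height ≤ n)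
    (h : ∀ Q : Ideal R, Q.IsPrime → I ≤ Q → n ≤ Q.height) : idealHt I = n := by
  refine le_antisymm ?_ (le_iInf fun Q => le_iInf fun hQ => le_iInf fun hIQ => ?_)
  · exact (iInf_le_of_le P (iInf₂_le ‹_› hIP)).trans ((primeHt_eq_height P).trans_le hP)
  · exact (h Q hQ hIQ).trans_eq (primeHt_eq_height Q).symm

section Substitution

variable {σ F : Type*} [Field F]

/-- The substitution `X j ↦ n j / a` for `j ∈ S`, fixing the other variables. -/
noncomputable def substAway (a : MvPolynomial σ F) (n : σ → MvPolynomial σ F) (S : Finset σ) :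
    MvPolynomial σ F →ₐ[F] Localization.Away a :=
  open Classical in
  aeval fun j => if j ∈ S then algebraMap (MvPolynomial σ F) _ (n j) * IsLocalization.Away.invSelf a
    else algebraMap (MvPolynomial σ F) _ (X j)

variable {a : MvPolynomial σ F} {n : σ → MvPolynomial σ F} {S : Finset σ}

theorem substAway_of_mem_supported {p : MvPolynomial σ F}
    (hp : p ∈ supported F (S : Set σ)ᶜ) :
    substAway a n S p = algebraMap _ _ p := by
  have h : supported F (S : Set σ)ᶜ ≤
      AlgHom.equalizer (substAway a n S) (IsScalarTower.toAlgHom F _ (Localization.Away a)) := by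
    refine Algebra.adjoin_le ?_
    rintro _ ⟨j, hj, rfl⟩
    have hj' : j ∉ S := by simpa using hj
    simp [substAway, hj']
  exact h hp

theorem substAway_relation (ha : a ∈ supported F (S : Set σ)ᶜ) {j : σ} (hj : j ∈ S)
    (hn : n j ∈ supported F (S : Set σ)ᶜ) : substAway a n S (a * X j - n j) = 0 := by
  rw [map_sub, map_mul, substAway_of_mem_supported ha, substAway_of_mem_supported hn]
  have h := IsLocalization.Away.mul_invSelf (S := Localization.Away a) a
  simp only [substAway, aeval_X, if_pos hj]
  linear_combination (algebraMap _ _ (n j)) * h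

/-- A prime avoiding `a` and containing all `a * X j - n j` contains the kernel of the
substitution. -/
theorem ker_substAway_le {P : Ideal (MvPolynomial σ F)} [P.IsPrime] (haP : a ∉ P)
    (h : ∀ j ∈ S, a * X j - n j ∈ P) : RingHom.ker (substAway a n S) ≤ P := by
  have hP : ∀ x, algebraMap _ (FractionRing (MvPolynomial σ F ⧸ P)) (Ideal.Quotient.mk P x) = 0 ↔
      x ∈ P := fun x => by
    rw [FaithfulSMul.algebraMap_eq_zero_iff, Ideal.Quotient.eq_zero_iff_mem]
  let π : MvPolynomial σ F →ₐ[F] FractionRing (MvPolynomial σ F ⧸ P) :=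
    (IsScalarTower.toAlgHom F (MvPolynomial σ F ⧸ P) _).comp (Ideal.Quotient.mkₐ F P)
  have hπ : ∀ x, π x = 0 ↔ x ∈ P := hP
  have hu : IsUnit (π a) := isUnit_iff_ne_zero.2 fun h0 => haP ((hπ a).1 h0)
  let ψ : Localization.Away a →+* FractionRing (MvPolynomial σ F ⧸ P) :=
    IsLocalization.Away.lift a (g := (π : MvPolynomial σ F →+* _)) hu
  have hψ : ∀ x, ψ (algebraMap _ _ x) = π x := fun x => IsLocalization.Away.lift_eq a hu x
  have hcomp : ψ.comp (substAway a n S : MvPolynomial σ F →+* _) = π := by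
    refine MvPolynomial.ringHom_ext (fun r => ?_) fun j => ?_
    · have hC : substAway a n S (C r) = algebraMap (MvPolynomial σ F) _ (C r) := by
        rw [substAway, aeval_C, IsScalarTower.algebraMap_apply F (MvPolynomial σ F)]
        rfl
      simp [hC, hψ]
    · by_cases hj : j ∈ S
      · have h1 := (hπ _).2 (h j hj)
        have h2 := congrArg ψ (IsLocalization.Away.mul_invSelf (S := Localization.Away a) a)
        rw [map_mul, hψ, map_one] at h2
        rw [map_sub, map_mul] at h1
        simp only [RingHom.comp_apply, RingHom.coe_coe, substAway, aeval_X, if_pos hj, map_mul, hψ]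
        linear_combination (-ψ (IsLocalization.Away.invSelf a)) * h1 + π (X j) * h2
      · simp [substAway, hj, hψ]
  intro x hx
  rw [← hπ, ← RingHom.coe_coe π, ← hcomp, RingHom.comp_apply, RingHom.coe_coe,
    (RingHom.mem_ker).1 hx, map_zero]

theorem mul_X_ne_of_mem_supported (ha0 : a ≠ 0) {s : Set σ} {j : σ} (hj : j ∉ s)
    {p : MvPolynomial σ F} (hp : p ∈ supported F s) : a * X j ≠ p := by
  classical
  intro h
  let κ : MvPolynomial σ F →ₐ[F] MvPolynomial σ F := aeval (Function.update X j 0)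
  have hle : supported F s ≤ AlgHom.equalizer κ (AlgHom.id F _) := by
    refine Algebra.adjoin_le ?_
    rintro _ ⟨i, hi, rfl⟩
    have hij : i ≠ j := fun e => hj (e ▸ hi)
    simp [κ, hij]
  have h1 : κ p = p := hle hp
  rw [← h, map_mul, show κ (X j) = 0 by simp [κ], mul_zero] at h1
  exact mul_ne_zero ha0 (X_ne_zero j) h1.symm

theorem card_le_height_ker_substAway (ha0 : a ≠ 0) (S : Finset σ)
    (ha : a ∈ supported F (S : Set σ)ᶜ)
    (hn : ∀ j ∈ S, n j ∈ supported F (S : Set σ)ᶜ) :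
    (S.card : ℕ∞) ≤ (RingHom.ker (substAway a n S)).height := by
  classical
  have : IsDomain (Localization.Away a) := IsLocalization.isDomain_localization
    (powers_le_nonZeroDivisors_of_noZeroDivisors ha0)
  have hinj : Function.Injective (algebraMap (MvPolynomial σ F) (Localization.Away a)) :=
    IsLocalization.injective _ (powers_le_nonZeroDivisors_of_noZeroDivisors ha0)
  induction S using Finset.induction_on with
  | empty => simp
  | insert j S hj ih =>
    have hsub : supported F ((insert j S : Finset σ) : Set σ)ᶜ ≤ supported F (S : Set σ)ᶜ :=
      supported_mono (Set.compl_subset_compl.2 (by simp))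
    have hjn := hn j (Finset.mem_insert_self j S)
    have hprime : ∀ T, (RingHom.ker (substAway a n T)).IsPrime := fun T => RingHom.ker_isPrime _
    have := hprime S
    have := hprime (insert j S)
    have haK : a ∉ RingHom.ker (substAway a n (insert j S)) := fun h => by
      rw [RingHom.mem_ker, substAway_of_mem_supported ha] at h
      exact ha0 (hinj (h.trans (map_zero _).symm))
    have hle : RingHom.ker (substAway a n S) ≤ RingHom.ker (substAway a n (insert j S)) :=
      ker_substAway_le haK fun i hi =>
        substAway_relation ha (Finset.mem_insert_of_mem hi) (hn i (Finset.mem_insert_of_mem hi))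
    have hlt : RingHom.ker (substAway a n S) < RingHom.ker (substAway a n (insert j S)) := by
      refine lt_of_le_of_ne hle fun h => ?_
      have hmem : a * X j - n j ∈ RingHom.ker (substAway a n S) :=
        h ▸ substAway_relation ha (Finset.mem_insert_self j S) hjn
      have hX : (X j : MvPolynomial σ F) ∈ supported F (S : Set σ)ᶜ :=
        X_mem_supported.2 (by simpa using hj)
      rw [RingHom.mem_ker, substAway_of_mem_supported
        (sub_mem (mul_mem (hsub ha) hX) (hsub hjn))] at hmem
      exact mul_X_ne_of_mem_supported ha0 (by simp) hjn
        (sub_eq_zero.1 (hinj (hmem.trans (map_zero _).symm)))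
    rw [Finset.card_insert_of_notMem hj, Nat.cast_add, Nat.cast_one]
    exact (add_le_add_left (ih (hsub ha) fun i hi => hsub (hn i (Finset.mem_insert_of_mem hi)))
      1).trans (Ideal.height_add_one_le_of_lt_of_isPrime hlt)

theorem card_le_height {P : Ideal (MvPolynomial σ F)} [P.IsPrime] (haP : a ∉ P)
    (ha : a ∈ supported F (S : Set σ)ᶜ)
    (hn : ∀ j ∈ S, n j ∈ supported F (S : Set σ)ᶜ) (h : ∀ j ∈ S, a * X j - n j ∈ P) :
    (S.card : ℕ∞) ≤ P.height :=
  (card_le_height_ker_substAway (by rintro rfl; exact haP P.zero_mem) S ha hn).trans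
    (Ideal.height_mono (ker_substAway_le haP h))

theorem three_le_height {P : Ideal (MvPolynomial σ F)} [P.IsPrime] (haP : a ∉ P) {i j k : σ}
    (hij : i ≠ j) (hik : i ≠ k) (hjk : j ≠ k) {p q r : MvPolynomial σ F}
    (ha : a ∈ supported F ({i, j, k} : Set σ)ᶜ) (hp : p ∈ supported F ({i, j, k} : Set σ)ᶜ)
    (hq : q ∈ supported F ({i, j, k} : Set σ)ᶜ) (hr : r ∈ supported F ({i, j, k} : Set σ)ᶜ)
    (hi : a * X i - p ∈ P) (hj : a * X j - q ∈ P) (hk : a * X k - r ∈ P) : 3 ≤ P.height := by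
  classical
  have h := card_le_height (S := {i, j, k})
    (n := fun l => if l = i then p else if l = j then q else r) haP
    (by simpa using ha)
    (by simp [hij.symm, hik.symm, hjk.symm, hp, hq, hr])
    (by simp [hij.symm, hik.symm, hjk.symm, hi, hj, hk])
  rwa [Finset.card_eq_three.2 ⟨i, j, k, hij, hik, hjk, rfl⟩] at h

end Substitution

/-- If an `F`-linear map on an `F`-algebra turns multiplication by scalars on `I` into
multiplication through `ε`, and `I` maps onto a space `V`, then `I` needs at least `dim V`
generators. -/
theorem finrank_le_of_span_range_eq {F R V : Type*} [Field F] [CommRing R]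
    [AddCommGroup V] [Module F V] {I : Ideal R} (ε : R → F) (Λ : R →+ V)
    (hΛ : ∀ r, ∀ x ∈ I, Λ (r * x) = ε r • Λ x) (hV : Submodule.span F (Λ '' I) = ⊤)
    {k : ℕ} (g : Fin k → R) (hg : Ideal.span (Set.range g) = I) : Module.finrank F V ≤ k := by
  have htop : Submodule.span F (Set.range (Λ ∘ g)) = ⊤ := by
    rw [eq_top_iff, ← hV, Submodule.span_le]
    rintro _ ⟨x, hx, rfl⟩
    rw [SetLike.mem_coe, ← hg] at hx
    obtain ⟨c, rfl⟩ := Ideal.mem_span_range_iff_exists_fun.1 hx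
    rw [map_sum]
    refine Submodule.sum_mem _ fun i _ => ?_
    rw [hΛ _ _ (hg ▸ Ideal.subset_span ⟨i, rfl⟩)]
    exact Submodule.smul_mem _ _ (Submodule.subset_span ⟨i, rfl⟩)
  have h := finrank_range_le_card (R := F) (Λ ∘ g)
  rwa [Set.finrank, htop, finrank_top, Fintype.card_fin] at h

/-- Restriction of a polynomial to the line through the origin spanned by `v`. -/
noncomputable def restrictLine {σ F : Type*} [Field F] (v : σ → F) :
    MvPolynomial σ F →ₐ[F] Polynomial F :=
  aeval fun i => Polynomial.C (v i) * Polynomial.X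

theorem coeff_zero_restrictLine {σ F : Type*} [Field F] (v : σ → F) (p : MvPolynomial σ F) :
    (restrictLine v p).coeff 0 = constantCoeff p := by
  have h : (Polynomial.constantCoeff.comp (restrictLine v : MvPolynomial σ F →+* _)) =
      constantCoeff := by
    refine MvPolynomial.ringHom_ext (fun r => ?_) fun i => ?_ <;> simp [restrictLine]
  exact RingHom.congr_fun h p

theorem coeff_two_restrictLine_mul {σ F : Type*} [Field F] (v : σ → F) (r : MvPolynomial σ F)
    {x : MvPolynomial σ F} (hx : Polynomial.X ^ 2 ∣ restrictLine v x) :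
    (restrictLine v (r * x)).coeff 2 = constantCoeff r * (restrictLine v x).coeff 2 := by
  obtain ⟨z, hz⟩ := hx
  rw [map_mul, hz, ← coeff_zero_restrictLine v r, mul_left_comm, Polynomial.coeff_X_pow_mul',
    Polynomial.coeff_X_pow_mul']
  simp [Polynomial.mul_coeff_zero]

section IntervalG

variable (F : Type*) [Field F]

/-- The five defining equations of the Kazhdan–Lusztig variety of the interval. -/
noncomputable def intervalGGen : Fin 5 → MvPolynomial (Fin 9) F :=
  ![X 0 * X 4 - X 1 * X 3, X 0 * X 5 - X 2 * X 3, X 1 * X 5 - X 2 * X 4,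
    X 0 * X 6 + X 1 * X 7 + X 2 * X 8, X 3 * X 6 + X 4 * X 7 + X 5 * X 8]

theorem range_intervalGGen : Set.range (intervalGGen F) =
    {X 0 * X 4 - X 1 * X 3, X 0 * X 5 - X 2 * X 3, X 1 * X 5 - X 2 * X 4,
      X 0 * X 6 + X 1 * X 7 + X 2 * X 8, X 3 * X 6 + X 4 * X 7 + X 5 * X 8} := by
  simp only [intervalGGen, Matrix.range_cons, Matrix.range_empty, Set.union_empty,
    Set.singleton_union]

/-- Points at which exactly one of the five equations is nonzero. -/
def intervalGPoint : Fin 5 → Fin 9 → F :=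
  ![Pi.single 0 1 + Pi.single 4 1, Pi.single 0 1 + Pi.single 5 1, Pi.single 1 1 + Pi.single 5 1,
    Pi.single 0 1 + Pi.single 6 1, Pi.single 3 1 + Pi.single 6 1]

variable {F}

theorem restrictLine_intervalGGen (v : Fin 9 → F) (l : Fin 5) :
    restrictLine v (intervalGGen F l) =
      Polynomial.C (MvPolynomial.eval v (intervalGGen F l)) * Polynomial.X ^ 2 := by
  fin_cases l <;> simp [restrictLine, intervalGGen] <;> ring

theorem eval_intervalGPoint (k l : Fin 5) :
    MvPolynomial.eval (intervalGPoint F k) (intervalGGen F l) = if k = l then 1 else 0 := by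
  fin_cases k <;> fin_cases l <;> simp [intervalGPoint, intervalGGen]

theorem X_sq_dvd_restrictLine (v : Fin 9 → F) {x : MvPolynomial (Fin 9) F}
    (hx : x ∈ Ideal.span (Set.range (intervalGGen F))) :
    Polynomial.X ^ 2 ∣ restrictLine v x := by
  have hle : Ideal.span (Set.range (intervalGGen F)) ≤
      (Ideal.span {Polynomial.X ^ 2}).comap (restrictLine v) := by
    rw [Ideal.span_le]
    rintro _ ⟨l, rfl⟩
    rw [SetLike.mem_coe, Ideal.mem_comap, Ideal.mem_span_singleton, restrictLine_intervalGGen]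
    exact dvd_mul_left _ _
  exact Ideal.mem_span_singleton.1 (hle hx)

theorem five_le_of_span_range_eq {k : ℕ} (g : Fin k → MvPolynomial (Fin 9) F)
    (hg : Ideal.span (Set.range g) = Ideal.span (Set.range (intervalGGen F))) : 5 ≤ k := by
  let Λ : MvPolynomial (Fin 9) F →+ (Fin 5 → F) :=
    { toFun := fun x i => (restrictLine (intervalGPoint F i) x).coeff 2
      map_zero' := by ext; simp
      map_add' := fun x y => by ext; simp }
  have hΛ : ∀ l, Λ (intervalGGen F l) = Pi.single l 1 := fun l => by
    ext i
    simp only [Λ, AddMonoidHom.coe_mk, ZeroHom.coe_mk, restrictLine_intervalGGen,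
      eval_intervalGPoint, Pi.single_apply]
    split_ifs <;> simp
  have h := finrank_le_of_span_range_eq (F := F) (fun r => constantCoeff r) Λ
    (fun r x hx => funext fun i =>
      coeff_two_restrictLine_mul _ r (X_sq_dvd_restrictLine _ hx)) ?_ g hg
  · simpa using h
  · rw [eq_top_iff, ← (Pi.basisFun F (Fin 5)).span_eq, Submodule.span_le]
    rintro _ ⟨l, rfl⟩
    exact Submodule.subset_span ⟨_, Ideal.subset_span ⟨l, rfl⟩, by simp [hΛ]⟩

theorem three_le_height_of_intervalGGen_mem {P : Ideal (MvPolynomial (Fin 9) F)} [P.IsPrime]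
    (h : ∀ l, intervalGGen F l ∈ P) : 3 ≤ P.height := by
  have h₀ : X 0 * X 4 - X 1 * X 3 ∈ P := h 0
  have h₁ : X 0 * X 5 - X 2 * X 3 ∈ P := h 1
  have h₂ : X 1 * X 5 - X 2 * X 4 ∈ P := h 2
  have h₃ : X 0 * X 6 + X 1 * X 7 + X 2 * X 8 ∈ P := h 3
  have hX : ∀ {s : Set (Fin 9)} {i}, i ∈ s → X i ∈ supported F s := X_mem_supported.2
  by_cases hP0 : X 0 ∈ P
  swap
  · refine three_le_height (i := 4) (j := 5) (k := 6) (p := X 1 * X 3)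
      (q := X 2 * X 3) (r := -(X 1 * X 7 + X 2 * X 8)) hP0
      (by decide) (by decide) (by decide) (hX (by simp)) (mul_mem (hX (by simp)) (hX (by simp)))
      (mul_mem (hX (by simp)) (hX (by simp))) (neg_mem (add_mem
        (mul_mem (hX (by simp)) (hX (by simp))) (mul_mem (hX (by simp)) (hX (by simp))))) ?_ ?_ ?_
    · exact h₀
    · exact h₁
    · convert h₃ using 1; ring
  by_cases hP1 : X 1 ∈ P
  swap
  · refine three_le_height (i := 3) (j := 5) (k := 7) (p := X 0 * X 4)
      (q := X 2 * X 4) (r := -(X 0 * X 6 + X 2 * X 8)) hP1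
      (by decide) (by decide) (by decide) (hX (by simp)) (mul_mem (hX (by simp)) (hX (by simp)))
      (mul_mem (hX (by simp)) (hX (by simp))) (neg_mem (add_mem
        (mul_mem (hX (by simp)) (hX (by simp))) (mul_mem (hX (by simp)) (hX (by simp))))) ?_ ?_ ?_
    · convert neg_mem h₀ using 1; ring
    · exact h₂
    · convert h₃ using 1; ring
  by_cases hP2 : X 2 ∈ P
  swap
  · refine three_le_height (i := 3) (j := 4) (k := 8) (p := X 0 * X 5)
      (q := X 1 * X 5) (r := -(X 0 * X 6 + X 1 * X 7)) hP2
      (by decide) (by decide) (by decide) (hX (by simp)) (mul_mem (hX (by simp)) (hX (by simp)))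
      (mul_mem (hX (by simp)) (hX (by simp))) (neg_mem (add_mem
        (mul_mem (hX (by simp)) (hX (by simp))) (mul_mem (hX (by simp)) (hX (by simp))))) ?_ ?_ ?_
    · convert neg_mem h₁ using 1; ring
    · convert neg_mem h₂ using 1; ring
    · convert h₃ using 1; ring
  refine three_le_height (a := 1) (i := 0) (j := 1) (k := 2) (p := 0) (q := 0) (r := 0)
    ((Ideal.ne_top_iff_one P).1 ‹P.IsPrime›.ne_top) (by decide) (by decide) (by decide)
    (one_mem _) (zero_mem _) (zero_mem _) (zero_mem _) ?_ ?_ ?_ <;> simpa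

theorem exists_prime_intervalGGen_mem_height_le :
    ∃ P : Ideal (MvPolynomial (Fin 9) F), P.IsPrime ∧ (∀ l, intervalGGen F l ∈ P) ∧
      P.height ≤ 3 := by
  classical
  let s : Finset (MvPolynomial (Fin 9) F) :=
    {X 0 * X 4 - X 1 * X 3, X 0 * X 5 - X 2 * X 3, X 0 * X 6 + X 1 * X 7 + X 2 * X 8}
  let M : Ideal (MvPolynomial (Fin 9) F) :=
    RingHom.ker (MvPolynomial.eval (Pi.single 0 1 : Fin 9 → F))
  have : M.IsPrime := RingHom.ker_isPrime _
  have hsM : Ideal.span (s : Set (MvPolynomial (Fin 9) F)) ≤ M := by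
    rw [Ideal.span_le]
    intro x hx
    simp only [s, Finset.coe_insert, Finset.coe_singleton, Set.mem_insert_iff,
      Set.mem_singleton_iff] at hx
    rcases hx with rfl | rfl | rfl <;> simp [M, RingHom.mem_ker]
  obtain ⟨P, hP, hPM⟩ := Ideal.exists_minimalPrimes_le hsM
  have hPp : P.IsPrime := hP.1.1
  have h0 : X 0 ∉ P := fun h => by simpa [M, RingHom.mem_ker] using hPM h
  have hmem : ∀ x ∈ s, x ∈ P := fun x hx => hP.1.2 (Ideal.subset_span hx)
  have h₀ : X 0 * X 4 - X 1 * X 3 ∈ P := hmem _ (by simp [s])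
  have h₁ : X 0 * X 5 - X 2 * X 3 ∈ P := hmem _ (by simp [s])
  have h₃ : X 0 * X 6 + X 1 * X 7 + X 2 * X 8 ∈ P := hmem _ (by simp [s])
  have h₂ : X 1 * X 5 - X 2 * X 4 ∈ P := by
    refine (hPp.mem_or_mem (?_ : X 0 * _ ∈ P)).resolve_left h0
    convert sub_mem (P.mul_mem_left (X 1) h₁) (P.mul_mem_left (X 2) h₀) using 1
    ring
  have h₄ : X 3 * X 6 + X 4 * X 7 + X 5 * X 8 ∈ P := by
    refine (hPp.mem_or_mem (?_ : X 0 * _ ∈ P)).resolve_left h0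
    convert add_mem (add_mem (P.mul_mem_left (X 3) h₃) (P.mul_mem_left (X 7) h₀))
      (P.mul_mem_left (X 8) h₁) using 1
    ring
  refine ⟨P, hPp, fun l => ?_, ?_⟩
  · fin_cases l <;> assumption
  · refine (Ideal.height_le_card_of_mem_minimalPrimes_span_finset hP).trans ?_
    exact_mod_cast Finset.card_le_three

end IntervalG

open MvPolynomial in
/-- In `R = F[a,…,i]` (with `a,…,i` the variables `X 0,…,X 8`), the ideal
`(ae−bd, af−cd, bf−ce, ag+bh+ci, dg+eh+fi)` has height `3` and every generating set has
at least `5` elements. -/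
theorem intervalG_ideal_not_lci (F : Type*) [Field F]
    (I : Ideal (MvPolynomial (Fin 9) F))
    (hI : I = Ideal.span
      {X 0 * X 4 - X 1 * X 3, X 0 * X 5 - X 2 * X 3, X 1 * X 5 - X 2 * X 4,
        X 0 * X 6 + X 1 * X 7 + X 2 * X 8, X 3 * X 6 + X 4 * X 7 + X 5 * X 8}) :
    idealHt I = 3 ∧
      ∀ (k : ℕ) (g : Fin k → MvPolynomial (Fin 9) F),
        Ideal.span (Set.range g) = I → 5 ≤ k := by
  rw [← range_intervalGGen] at hI
  subst hI
  refine ⟨?_, fun k g hg => five_le_of_span_range_eq g hg⟩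
  obtain ⟨P, hP, hmem, hle⟩ := exists_prime_intervalGGen_mem_height_le (F := F)
  refine idealHt_eq_of_le (P := P) (Ideal.span_le.2 ?_) hle fun Q hQ hIQ =>
    three_le_height_of_intervalGGen_mem fun l => hIQ (Ideal.subset_span ⟨l, rfl⟩)
  rintro _ ⟨l, rfl⟩
  exact hmem l
end
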